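/- For all a, b ∈ ℝ^m, the parallel translations A_a and A_b are sign equivalent, i.e. sign(A_a) = sign(A_b), if and only if a and b lie in the same open face of the derived arrangement δA_o, i.e. for every circuit vector c the numbers ⟨c,a⟩ and ⟨c,b⟩ have the same sign (both zero, both positive, or both negative). -/

import Mathlib

open RealInnerProductSpace

noncomputable section

/-- `ℝ^n` with the Euclidean inner product. -/
abbrev Euc (n : ℕ) := EuclideanSpace ℝ (Fin n)

/-- Standard scalar product on `ℝ^m` (as tuples). -/
def dotm {m : ℕ} (c a : Fin m → ℝ) : ℝ := ∑ i, c i * a i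

/-- `C` is a circuit: the family `{u i : i ∈ C}` is linearly dependent but every proper
subfamily is linearly independent. -/
def IsCircuit {n m : ℕ} (u : Fin m → Euc n) (C : Set (Fin m)) : Prop :=
  ¬ LinearIndependent ℝ (fun i : C => u i) ∧
    ∀ D : Set (Fin m), D ⊂ C → LinearIndependent ℝ (fun i : D => u i)

/-- `c` is a circuit vector: `∑ i, c i • u i = 0` and the support of `c` is a circuit. -/
def IsCircuitVector {n m : ℕ} (u : Fin m → Euc n) (c : Fin m → ℝ) : Prop :=
  (∑ i, c i • u i) = 0 ∧ IsCircuit u {i | c i ≠ 0}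

/-- `a` and `b` lie in the same open face of the derived arrangement `δA_o`:
for every circuit vector `c`, `⟨c,a⟩` and `⟨c,b⟩` have the same sign. -/
def SameOpenFace {n m : ℕ} (u : Fin m → Euc n) (a b : Fin m → ℝ) : Prop :=
  ∀ c : Fin m → ℝ, IsCircuitVector u c →
    SignType.sign (dotm c a) = SignType.sign (dotm c b)

/-- `I, J, K` is a partition of `{1,…,m}` into pairwise disjoint (possibly empty) sets. -/
def IsTripartition {m : ℕ} (I J K : Set (Fin m)) : Prop :=
  I ∪ J ∪ K = Set.univ ∧ Disjoint I J ∧ Disjoint I K ∧ Disjoint J K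

/-- The convex polyhedron `P(a,I,J,K)`. -/
def poly {n m : ℕ} (u : Fin m → Euc n) (a : Fin m → ℝ) (I J K : Set (Fin m)) :
    Set (Euc n) :=
  {x | (∀ i ∈ I, ⟪u i, x⟫ = a i) ∧ (∀ j ∈ J, ⟪u j, x⟫ ≤ a j) ∧ (∀ k ∈ K, a k ≤ ⟪u k, x⟫)}

/-- The normal cone of `P` at `x`. -/
def normalCone {n : ℕ} (P : Set (Euc n)) (x : Euc n) : Set (Euc n) :=
  {v | ∀ y ∈ P, ⟪v, y⟫ ≤ ⟪v, x⟫}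

/-- The normal fan of `P`: the family of normal cones at points of `P`. -/
def normalFan {n : ℕ} (P : Set (Euc n)) : Set (Set (Euc n)) :=
  {N | ∃ x ∈ P, N = normalCone P x}

/-- A face of a convex polyhedron: the empty set or an exposed face. -/
def IsFace {n : ℕ} (P F : Set (Euc n)) : Prop :=
  F = ∅ ∨ ∃ v : Euc n, F = {x ∈ P | ∀ y ∈ P, ⟪v, y⟫ ≤ ⟪v, x⟫}

/-- The set of sign vectors of the parallel translation `A_a`. -/
def signSet {n m : ℕ} (u : Fin m → Euc n) (a : Fin m → ℝ) : Set (Fin m → SignType) :=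
  {s | ∃ x : Euc n, ∀ i, s i = SignType.sign (⟪u i, x⟫ - a i)}

/-- `c` is conformal to `l`. -/
def Conf {m : ℕ} (c l : Fin m → ℝ) : Prop := ∀ i, 0 ≤ c i * l i ∧ (l i = 0 → c i = 0)

theorem Conf.trans' {m : ℕ} {c d l : Fin m → ℝ} (h1 : Conf c d) (h2 : Conf d l) : Conf c l := by
  intro i
  refine ⟨?_, fun h => (h1 i).2 ((h2 i).2 h)⟩
  by_cases hd : d i = 0
  · rw [(h1 i).2 hd]; simp
  · have h3 : 0 < d i * d i := mul_self_pos.2 hd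
    have h4 := mul_nonneg (h1 i).1 (h2 i).1
    by_contra hneg
    push Not at hneg
    nlinarith

theorem reduce_conf {m : ℕ} (c g : Fin m → ℝ) (hs : ∀ i, c i = 0 → g i = 0)
    (hpos : ∃ i, 0 < g i * c i) :
    ∃ e : ℝ, 0 < e ∧ Conf (c - e • g) c ∧ ∃ j, c j ≠ 0 ∧ (c - e • g) j = 0 := by
  classical
  obtain ⟨i0, hi0⟩ := hpos
  let S : Finset (Fin m) := Finset.univ.filter fun i => 0 < g i * c i
  have hS : S.Nonempty := ⟨i0, by simp [S, hi0]⟩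
  obtain ⟨j, hj, hmin⟩ := S.exists_min_image (fun i => c i / g i) hS
  have hj' : 0 < g j * c j := by simpa [S] using hj
  have hgj : g j ≠ 0 := by rintro h; simp [h] at hj'
  have hcj : c j ≠ 0 := by rintro h; simp [h] at hj'
  have he : 0 < c j / g j := by
    have : c j / g j = (g j * c j) / (g j * g j) := by field_simp
    rw [this]
    exact div_pos hj' (mul_self_pos.2 hgj)
  refine ⟨c j / g j, he, ?_, j, hcj, ?_⟩
  · intro i
    refine ⟨?_, fun h => by simp [h, hs i h]⟩
    simp only [Pi.sub_apply, Pi.smul_apply, smul_eq_mul]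
    by_cases hi : 0 < g i * c i
    · have h1 := hmin i (by simp [S, hi])
      have hgi : g i ≠ 0 := by rintro h; simp [h] at hi
      have h2 : c i / g i * (g i * c i) = c i * c i := by field_simp
      have h3 := mul_le_mul_of_nonneg_right h1 hi.le
      rw [h2] at h3
      nlinarith
    · push Not at hi
      nlinarith [mul_self_nonneg (c i), mul_nonneg he.le (neg_nonneg.2 hi)]
  · simp [hgj]

open Classical in
theorem sum_extend {n m : ℕ} (D : Set (Fin m)) (F : Fin m → Euc n)
    (hF : ∀ i, i ∉ D → F i = 0) : ∑ i : D, F i = ∑ i, F i := by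
  rw [← Finset.sum_subtype (Finset.univ.filter (· ∈ D)) (by simp) F]
  apply Finset.sum_filter_of_ne
  intro i _ h
  by_contra hi
  exact h (hF i hi)

theorem dep_iff {n m : ℕ} (u : Fin m → Euc n) (D : Set (Fin m)) :
    ¬ LinearIndependent ℝ (fun i : D => u i) ↔
      ∃ g : Fin m → ℝ, (∀ i, i ∉ D → g i = 0) ∧ ∑ i, g i • u i = 0 ∧ g ≠ 0 := by
  classical
  rw [Fintype.not_linearIndependent_iff]
  constructor
  · rintro ⟨g, hg, i, hi⟩
    refine ⟨fun i => if h : i ∈ D then g ⟨i, h⟩ else 0, fun i hi => by simp [hi], ?_, ?_⟩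
    · rw [← sum_extend D _ (fun i hi => by simp [hi]), ← hg]
      exact Finset.sum_congr rfl fun i _ => by simp
    · intro h
      have := congrFun h i
      simp at this
      exact hi this
  · rintro ⟨g, hD, hg, hne⟩
    refine ⟨fun i => g i, ?_, ?_⟩
    · rw [← hg, ← sum_extend D (fun i => g i • u i) (fun i hi => by simp [hD i hi])]
    · by_contra hall
      push Not at hall
      apply hne
      ext i
      by_cases h : i ∈ D
      · exact hall ⟨i, h⟩
      · exact hD i h

theorem exists_conf_circuit {n m : ℕ} (u : Fin m → Euc n) (l : Fin m → ℝ)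
    (hl : ∑ i, l i • u i = 0) (hne : l ≠ 0) :
    ∃ c, IsCircuitVector u c ∧ Conf c l ∧ c ≠ 0 := by
  classical
  let P : ℕ → Prop := fun k => ∃ c : Fin m → ℝ, ∑ i, c i • u i = 0 ∧ c ≠ 0 ∧ Conf c l ∧
    (Finset.univ.filter fun i => c i ≠ 0).card = k
  have hP : ∃ k, P k := ⟨_, l, hl, hne, fun i => ⟨mul_self_nonneg _, id⟩, rfl⟩
  obtain ⟨c, hc, hc0, hcl, hk⟩ := Nat.find_spec hP
  refine ⟨c, ⟨hc, ?_, ?_⟩, hcl, hc0⟩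
  · rw [dep_iff]
    exact ⟨c, fun i hi => by simpa using hi, hc, hc0⟩
  · intro D hD
    by_contra hdep
    rw [dep_iff] at hdep
    obtain ⟨g, hg1, hg2, hg3⟩ := hdep
    have hgs : ∀ i, c i = 0 → g i = 0 := fun i hi => hg1 i fun h => (hD.1 h) hi
    obtain ⟨g, hg1, hg2, hgs, hpos⟩ : ∃ g : Fin m → ℝ, (∀ i, i ∉ D → g i = 0) ∧
        ∑ i, g i • u i = 0 ∧ (∀ i, c i = 0 → g i = 0) ∧ ∃ i, 0 < g i * c i := by
      obtain ⟨i, hi⟩ : ∃ i, g i ≠ 0 := by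
        by_contra h
        push Not at h
        exact hg3 (funext h)
      have hci : c i ≠ 0 := fun h => hi (hgs i h)
      rcases lt_or_gt_of_ne (mul_ne_zero hi hci) with h | h
      · refine ⟨-g, fun i hi => by simp [hg1 i hi], by simp [hg2], fun i hi => by simp [hgs i hi],
          i, ?_⟩
        simp only [Pi.neg_apply]; linarith
      · exact ⟨g, hg1, hg2, hgs, i, h⟩
    obtain ⟨e, he, hconf, j, hj, hj0⟩ := reduce_conf c g hgs hpos
    obtain ⟨k, hk1, hk2⟩ := Set.exists_of_ssubset hD
    refine Nat.find_min hP (m := (Finset.univ.filter fun i => (c - e • g) i ≠ 0).card) ?_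
      ⟨c - e • g, ?_, ?_, hconf.trans' hcl, rfl⟩
    · rw [← hk]
      apply Finset.card_lt_card
      refine ⟨fun i hi => ?_, fun hsub => ?_⟩
      · simp only [Finset.mem_filter, Finset.mem_univ, true_and] at hi ⊢
        exact fun h => hi ((hconf i).2 h)
      · have := hsub (x := j) (by simp [hj])
        simp only [Finset.mem_filter, Finset.mem_univ, true_and] at this
        exact this hj0
    · simp [sub_smul, mul_smul, Finset.sum_sub_distrib, ← Finset.smul_sum, hc, hg2]
    · intro h
      have := congrFun h k
      simp [hg1 k hk2] at this
      exact hk1 this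

theorem circuit_smul {n m : ℕ} (u : Fin m → Euc n) (c : Fin m → ℝ) (e : ℝ) (he : e ≠ 0)
    (hc : IsCircuitVector u c) : IsCircuitVector u (e • c) := by
  refine ⟨?_, ?_⟩
  · simp [mul_smul, ← Finset.smul_sum, hc.1]
  · have : {i | (e • c) i ≠ 0} = {i | c i ≠ 0} := by ext i; simp [he]
    rw [this]; exact hc.2

theorem conf_induction {n m : ℕ} (u : Fin m → Euc n) (p : (Fin m → ℝ) → Prop) (h0 : p 0)
    (hadd : ∀ c d, p c → p d → p (c + d)) :
    ∀ (k : ℕ) (l : Fin m → ℝ), (Finset.univ.filter fun i => l i ≠ 0).card = k →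
    ∑ i, l i • u i = 0 →
    (∀ c, IsCircuitVector u c → Conf c l → p c) → p l := by
  classical
  intro k
  induction k using Nat.strong_induction_on with
  | _ k ih =>
    intro l hk hl hp
    by_cases hl0 : l = 0
    · rw [hl0]; exact h0
    obtain ⟨c, hc, hcl, hc0⟩ := exists_conf_circuit u l hl hl0
    obtain ⟨i, hi⟩ : ∃ i, c i ≠ 0 := by
      by_contra h
      push Not at h
      exact hc0 (funext h)
    have hli : l i ≠ 0 := fun h => hi ((hcl i).2 h)
    obtain ⟨e, he, hconf, j, hj, hj0⟩ := reduce_conf l c (fun i h => (hcl i).2 h)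
      ⟨i, lt_of_le_of_ne (hcl i).1 (mul_ne_zero hi hli).symm⟩
    have h1 : p (e • c) := by
      refine hp _ (circuit_smul u c e he.ne' hc) fun i => ⟨?_, fun h => by simp [(hcl i).2 h]⟩
      simp only [Pi.smul_apply, smul_eq_mul, mul_assoc]
      exact mul_nonneg he.le (hcl i).1
    have h2 : p (l - e • c) := by
      refine ih (Finset.univ.filter fun i => (l - e • c) i ≠ 0).card ?_ _ rfl ?_
        fun d hd hdl => hp d hd (hdl.trans' hconf)
      · rw [← hk]
        apply Finset.card_lt_card
        refine ⟨fun i hi => ?_, fun hsub => ?_⟩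
        · simp only [Finset.mem_filter, Finset.mem_univ, true_and] at hi ⊢
          exact fun h => hi ((hconf i).2 h)
        · have := hsub (x := j) (by simp [hj])
          simp only [Finset.mem_filter, Finset.mem_univ, true_and] at this
          exact this hj0
      · simp [sub_smul, mul_smul, Finset.sum_sub_distrib, ← Finset.smul_sum, hl, hc.1]
    simpa using hadd _ _ h2 h1

theorem solve_eqs {n m : ℕ} (u : Fin m → Euc n) (Z : Set (Fin m)) (b : Fin m → ℝ)
    (h : ∀ l : Fin m → ℝ, (∀ i, i ∉ Z → l i = 0) → ∑ i, l i • u i = 0 → dotm l b = 0) :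
    ∃ x : Euc n, ∀ i ∈ Z, ⟪u i, x⟫ = b i := by
  classical
  let T : Euc n →ₗ[ℝ] Euc m :=
    { toFun := fun x => WithLp.toLp 2 fun i => if i ∈ Z then ⟪u i, x⟫ else 0
      map_add' := by
        intro x y; ext i; by_cases hi : i ∈ Z <;> simp [hi, inner_add_right]
      map_smul' := by
        intro r x; ext i; by_cases hi : i ∈ Z <;> simp [hi, inner_smul_right] }
  let y : Euc m := WithLp.toLp 2 fun i => if i ∈ Z then b i else 0
  have hy : y ∈ LinearMap.range T := by
    rw [← Submodule.orthogonal_orthogonal (LinearMap.range T), Submodule.mem_orthogonal]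
    intro v hv
    have hv' : ∀ x, ∑ i, (if i ∈ Z then v i else 0) * ⟪u i, x⟫ = 0 := by
      intro x
      have := (Submodule.mem_orthogonal _ _).1 hv (T x) ⟨x, rfl⟩
      rw [PiLp.inner_apply] at this
      rw [← this]
      apply Finset.sum_congr rfl
      intro i _
      by_cases hi : i ∈ Z <;> simp [T, hi]
    have h0 : ∑ i, (if i ∈ Z then v i else 0) • u i = 0 := by
      rw [← inner_self_eq_zero (𝕜 := ℝ)]
      conv_lhs => rw [sum_inner]
      rw [← hv' (∑ i, (if i ∈ Z then v i else 0) • u i)]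
      apply Finset.sum_congr rfl
      intro i _
      rw [real_inner_smul_left]
    have := h (fun i => if i ∈ Z then v i else 0) (fun i hi => by simp [hi]) h0
    rw [PiLp.inner_apply, ← this, dotm]
    apply Finset.sum_congr rfl
    intro i _
    by_cases hi : i ∈ Z <;> simp [y, hi, mul_comm]
  obtain ⟨x, hx⟩ := hy
  refine ⟨x, fun i hi => ?_⟩
  have := congrArg (fun w : Euc m => w i) hx
  simpa [T, y, hi] using this

theorem dotm_inner {n m : ℕ} (u : Fin m → Euc n) (c : Fin m → ℝ) (hc : ∑ i, c i • u i = 0)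
    (x : Euc n) : dotm c (fun i => ⟪u i, x⟫) = 0 := by
  have : ⟪∑ i, c i • u i, x⟫ = 0 := by rw [hc, inner_zero_left]
  rw [sum_inner] at this
  rw [dotm, ← this]
  exact Finset.sum_congr rfl fun i _ => by rw [real_inner_smul_left]

theorem dotm_add {m : ℕ} (c a b : Fin m → ℝ) : dotm c (a + b) = dotm c a + dotm c b := by
  simp [dotm, mul_add, Finset.sum_add_distrib]

theorem dotm_sub {m : ℕ} (c a b : Fin m → ℝ) : dotm c (a - b) = dotm c a - dotm c b := by
  simp [dotm, mul_sub, Finset.sum_sub_distrib]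

theorem dotm_add_left {m : ℕ} (c d b : Fin m → ℝ) : dotm (c + d) b = dotm c b + dotm d b := by
  simp [dotm, add_mul, Finset.sum_add_distrib]

theorem forward_dir {n m : ℕ} (u : Fin m → Euc n) (a b : Fin m → ℝ)
    (h : signSet u a ⊆ signSet u b) : SameOpenFace u a b := by
  intro c hc
  obtain ⟨j, hj⟩ : ∃ j, c j ≠ 0 := by
    by_contra hno
    push Not at hno
    apply hc.2.1
    have : IsEmpty {i | c i ≠ 0} := ⟨fun i => i.2 (hno i)⟩
    exact linearIndependent_empty_type
  obtain ⟨x, hx⟩ := solve_eqs u ({i | c i ≠ 0} \ {j}) a (by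
    intro l hl1 hl2
    have hli := hc.2.2 ({i | c i ≠ 0} \ {j})
      ⟨Set.sdiff_subset, fun hs => (hs (show j ∈ {i | c i ≠ 0} from hj)).2 rfl⟩
    by_cases hl0 : l = 0
    · simp [hl0, dotm]
    · exact absurd hli ((dep_iff u _).2 ⟨l, hl1, hl2, hl0⟩))
  obtain ⟨y, hy⟩ := h ⟨x, fun i => rfl⟩
  replace hy : ∀ i, SignType.sign (⟪u i, x⟫ - a i) = SignType.sign (⟪u i, y⟫ - b i) := hy
  have hform : ∀ (d : Fin m → ℝ) (z : Euc n), (∀ i, c i ≠ 0 → i ≠ j → ⟪u i, z⟫ - d i = 0) →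
      dotm c d = - (c j * (⟪u j, z⟫ - d j)) := by
    intro d z hz
    have h1 := dotm_sub c (fun i => ⟪u i, z⟫) d
    rw [dotm_inner u c hc.1 z] at h1
    have h2 : dotm c ((fun i => ⟪u i, z⟫) - d) = c j * (⟪u j, z⟫ - d j) := by
      rw [dotm, Finset.sum_eq_single j]
      · rfl
      · intro i _ hij
        by_cases hci : c i = 0
        · simp [hci]
        · simp only [Pi.sub_apply, hz i hci hij, mul_zero]
      · simp
    linarith
  have hxa : ∀ i, c i ≠ 0 → i ≠ j → ⟪u i, x⟫ - a i = 0 := fun i hi hij => by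
    rw [hx i ⟨hi, hij⟩, sub_self]
  rw [hform a x hxa, hform b y fun i hi hij => by
    have := hy i
    rw [hxa i hi hij, sign_zero] at this
    exact sign_eq_zero_iff.1 this.symm]
  rw [Left.sign_neg, Left.sign_neg, sign_mul, sign_mul, hy j]

theorem motzkin {n m : ℕ} (u : Fin m → Euc n) (a b : Fin m → ℝ)
    (h : ∀ l : Fin m → ℝ, ∑ i, l i • u i = 0 → (∀ i, 0 ≤ l i * a i) →
      (0 < dotm l a ∧ 0 < dotm l b) ∨ (dotm l a = 0 ∧ dotm l b = 0)) :
    ∃ x : Euc n, ∀ i, SignType.sign (⟪u i, x⟫ + b i) = SignType.sign (a i) := by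
  classical
  -- solve the equations on the zero set of `a`
  obtain ⟨x0, hx0⟩ := solve_eqs u {i | a i = 0} (-b) (by
    intro l hl1 hl2
    have hla : ∀ i, l i * a i = 0 := by
      intro i
      by_cases hi : a i = 0
      · simp [hi]
      · simp [hl1 i hi]
    have hda : dotm l a = 0 := Finset.sum_eq_zero fun i _ => hla i
    rcases h l hl2 (fun i => (hla i).ge) with h1 | h1
    · exact absurd hda h1.1.ne'
    · have : dotm l (-b) = - dotm l b := by simp [dotm]
      rw [this, h1.2, neg_zero])
  let w : Fin m → ℝ := (fun i => ⟪u i, x0⟫) + b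
  have hw0 : ∀ i, a i = 0 → w i = 0 := by
    intro i hi
    have := hx0 i hi
    simp only [w, Pi.add_apply, this, Pi.neg_apply, neg_add_cancel]
  let O : Set (Fin m → ℝ) := {t | ∀ i, a i ≠ 0 → 0 < t i * a i}
  let X : Submodule ℝ (Euc n) := (Submodule.span ℝ (u '' {i | a i = 0}))ᗮ
  have hX : ∀ x ∈ X, ∀ i, a i = 0 → ⟪u i, x⟫ = 0 := fun x hx i hi =>
    (Submodule.mem_orthogonal _ _).1 hx _ (Submodule.subset_span ⟨i, hi, rfl⟩)
  let B : Set (Fin m → ℝ) := {t | ∃ x ∈ X, ∀ i, t i = ⟪u i, x⟫ + w i}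
  by_cases hdisj : Disjoint O B
  · exfalso
    have hOc : Convex ℝ O := by
      intro s hs t ht p q hp hq hpq i hi
      have h1 := hs i hi
      have h2 := ht i hi
      have h3 : (p • s + q • t) i * a i = p * (s i * a i) + q * (t i * a i) := by
        simp; ring
      rw [h3]
      rcases hp.eq_or_lt with hp | hp
      · have : q = 1 := by linarith
        simp [← hp, this, h2]
      · have := mul_pos hp h1
        have := mul_nonneg hq h2.le
        linarith
    have hOo : IsOpen O := by
      have : O = ⋂ i, {t : Fin m → ℝ | a i ≠ 0 → 0 < t i * a i} := by
        ext t; simp [O]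
      rw [this]
      apply isOpen_iInter_of_finite
      intro i
      by_cases hi : a i = 0
      · simp [hi]
      · simp only [ne_eq, hi, not_false_eq_true, forall_const]
        exact isOpen_lt continuous_const (by fun_prop)
    have hBc : Convex ℝ B := by
      rintro s ⟨x, hx, hs⟩ t ⟨y, hy, ht⟩ p q hp hq hpq
      refine ⟨p • x + q • y, X.add_mem (X.smul_mem _ hx) (X.smul_mem _ hy), fun i => ?_⟩
      simp only [Pi.add_apply, Pi.smul_apply, smul_eq_mul, hs, ht, inner_add_right,
        real_inner_smul_right]
      have : q = 1 - p := by linarith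
      rw [this]; ring
    obtain ⟨f, r, hfO, hfB⟩ := geometric_hahn_banach_open hOc hOo hBc hdisj
    let g : Fin m → ℝ := fun i => f (Pi.single i 1)
    have hfg : ∀ t, f t = dotm g t := by
      intro t
      conv_lhs => rw [pi_eq_sum_univ' t]
      rw [map_sum, dotm]
      apply Finset.sum_congr rfl
      intro i _
      rw [map_smul, smul_eq_mul, mul_comm]
    have haO : a ∈ O := fun i hi => mul_self_pos.2 hi
    -- cone property
    have hcone : ∀ t, (∀ e : ℝ, 0 < e → a + e • t ∈ O) → f t ≤ 0 := by
      intro t ht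
      by_contra hpos
      push Not at hpos
      have hE : 0 < (|r - f a| + 1) / f t := by positivity
      have := hfO _ (ht _ hE)
      rw [map_add, map_smul, smul_eq_mul, div_mul_cancel₀ _ hpos.ne'] at this
      have := le_abs_self (r - f a)
      linarith
    have hr : 0 ≤ r := by
      by_contra hneg
      push Not at hneg
      have hfa : f a ≤ 0 := hcone a fun e he i hi => by
        have := mul_self_pos.2 hi
        simp only [Pi.add_apply, Pi.smul_apply, smul_eq_mul]
        nlinarith [mul_pos he this]
      have hE : 0 < -r / (|f a| + 1) := div_pos (by linarith) (by positivity)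
      have h1 := hfO ((-r / (|f a| + 1)) • a) fun i hi => by
        have := mul_self_pos.2 hi
        simp only [Pi.smul_apply, smul_eq_mul, mul_assoc]
        exact mul_pos hE this
      rw [map_smul, smul_eq_mul, div_mul_eq_mul_div, div_lt_iff₀ (by positivity)] at h1
      have := neg_abs_le (f a)
      nlinarith
    have hgz : ∀ i, a i = 0 → g i = 0 := by
      intro i hi
      have h1 : ∀ s : ℝ, f (s • Pi.single i 1) ≤ 0 := by
        intro s
        apply hcone
        intro e he k hk
        have hki : k ≠ i := by rintro rfl; exact hk hi
        simp [hki, hk]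
      have h2 := h1 1
      have h3 := h1 (-1)
      rw [map_smul, smul_eq_mul] at h2 h3
      change f (Pi.single i 1) = 0
      linarith
    have hga : ∀ i, g i * a i ≤ 0 := by
      intro i
      have h1 : f (a i • Pi.single i 1) ≤ 0 := by
        apply hcone
        intro e he k hk
        by_cases hki : k = i
        · subst hki
          have := mul_self_pos.2 hk
          simp only [Pi.add_apply, Pi.smul_apply, Pi.single_eq_same, smul_eq_mul, mul_one]
          nlinarith [mul_pos he this]
        · simp [hki, hk]
      rw [map_smul, smul_eq_mul, mul_comm] at h1
      exact h1
    -- `f` vanishes on the direction of `B`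
    have hwB : ∀ x ∈ X, r ≤ f (fun i => ⟪u i, x⟫) + f w := by
      intro x hx
      rw [← map_add]
      exact hfB _ ⟨x, hx, fun i => rfl⟩
    have hlin : ∀ x, f (fun i => ⟪u i, x⟫) = ⟪∑ i, g i • u i, x⟫ := by
      intro x
      rw [hfg, sum_inner, dotm]
      exact Finset.sum_congr rfl fun i _ => by rw [real_inner_smul_left]
    have hvan : ∀ x ∈ X, ⟪∑ i, g i • u i, x⟫ = 0 := by
      intro x hx
      by_contra hne
      have h1 := hwB (((r - f w - 1) / ⟪∑ i, g i • u i, x⟫) • x) (X.smul_mem _ hx)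
      rw [hlin, real_inner_smul_right, div_mul_cancel₀ _ hne] at h1
      linarith
    have hspan : ∑ i, g i • u i ∈ Submodule.span ℝ (u '' {i | a i = 0}) := by
      rw [← Submodule.orthogonal_orthogonal (Submodule.span ℝ (u '' {i | a i = 0})),
        Submodule.mem_orthogonal]
      intro x hx
      rw [real_inner_comm]
      exact hvan x hx
    obtain ⟨μ, hμ1, hμ2⟩ : ∃ μ : Fin m → ℝ, (∀ i, a i ≠ 0 → μ i = 0) ∧
        ∑ i, μ i • u i = ∑ i, g i • u i := by
      rw [Finsupp.mem_span_image_iff_linearCombination] at hspan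
      obtain ⟨l, hl, hl2⟩ := hspan
      refine ⟨l, fun i hi => ?_, ?_⟩
      · by_contra hli
        exact hi ((Finsupp.mem_supported _ _).1 hl (by simpa using hli))
      · rw [← hl2, Finsupp.linearCombination_apply, Finsupp.sum_fintype _ _ (by simp)]
    have hla : ∀ i, (μ - g) i * a i = - (g i * a i) := by
      intro i
      by_cases hi : a i = 0
      · simp [hi]
      · simp [hμ1 i hi]
    have hdep : ∑ i, (μ - g) i • u i = 0 := by
      simp [sub_smul, Finset.sum_sub_distrib, hμ2]
    have hdw : dotm (μ - g) b = - f w := by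
      have h1 : dotm (μ - g) w = dotm (μ - g) b := by
        rw [dotm_add, dotm_inner u _ hdep, zero_add]
      rw [← h1, hfg, dotm, dotm, ← Finset.sum_neg_distrib]
      apply Finset.sum_congr rfl
      intro i _
      by_cases hi : a i = 0
      · simp [hw0 i hi]
      · simp [hμ1 i hi]
    have hda : dotm (μ - g) a = - f a := by
      rw [hfg, dotm, dotm, ← Finset.sum_neg_distrib]
      exact Finset.sum_congr rfl fun i _ => hla i
    have hfw : r ≤ f w := by
      have := hwB 0 X.zero_mem
      rw [hlin, inner_zero_right, zero_add] at this
      exact this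
    rcases h (μ - g) hdep (fun i => by rw [hla]; linarith [hga i]) with h1 | h1
    · linarith [h1.2]
    · have h2 : f w = 0 := by linarith [h1.2]
      have h3 : f a = 0 := by linarith [h1.1]
      have h4 := hfO a haO
      linarith
  · rw [Set.not_disjoint_iff] at hdisj
    obtain ⟨t, htO, x, hx, ht⟩ := hdisj
    refine ⟨x + x0, fun i => ?_⟩
    have hti : ⟪u i, x + x0⟫ + b i = t i := by
      rw [ht, inner_add_right]; simp only [w, Pi.add_apply]; ring
    rw [hti]
    by_cases hi : a i = 0
    · rw [ht, hX x hx i hi, hw0 i hi, hi, add_zero]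
    · have := htO i hi
      rcases lt_or_gt_of_ne hi with h1 | h1
      · rw [sign_neg h1, sign_neg (neg_of_mul_pos_left this h1.le)]
      · rw [sign_pos h1, sign_pos (pos_of_mul_pos_left this h1.le)]

theorem backward_dir {n m : ℕ} (u : Fin m → Euc n) (a b : Fin m → ℝ)
    (h : SameOpenFace u a b) : signSet u a ⊆ signSet u b := by
  rintro s ⟨x, hx⟩
  let a' : Fin m → ℝ := (fun i => ⟪u i, x⟫) - a
  obtain ⟨y, hy⟩ := motzkin u a' (-b) (by
    intro l hl hla
    refine conf_induction u (fun l => (0 < dotm l a' ∧ 0 < dotm l (-b)) ∨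
      (dotm l a' = 0 ∧ dotm l (-b) = 0)) (by simp [dotm]) ?_ _ l rfl hl ?_
    · intro c d hc hd
      simp only [dotm_add_left]
      rcases hc with hc | hc <;> rcases hd with hd | hd
      · left; constructor <;> linarith
      · left; constructor <;> linarith
      · left; constructor <;> linarith
      · right; constructor <;> linarith
    · intro c hc hcl
      have h1 : dotm c a' = - dotm c a := by
        rw [dotm_sub, dotm_inner u c hc.1, zero_sub]
      have h2 : dotm c (-b) = - dotm c b := by simp [dotm]
      have h3 : 0 ≤ dotm c a' := by
        apply Finset.sum_nonneg
        intro i _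
        by_cases hli : l i = 0
        · simp [(hcl i).2 hli]
        · have h4 := mul_nonneg (hcl i).1 (hla i)
          have h5 := mul_self_pos.2 hli
          by_contra hneg
          push Not at hneg
          nlinarith
      have h4 := h c hc
      simp only [h1, h2] at h3 ⊢
      rcases h3.eq_or_lt with h5 | h5
      · right
        have h6 : dotm c a = 0 := by linarith
        rw [h6, sign_zero] at h4
        have := sign_eq_zero_iff.1 h4.symm
        constructor <;> linarith
      · left
        have h6 : dotm c a < 0 := by linarith
        rw [sign_neg h6] at h4
        have := sign_eq_neg_one_iff.1 h4.symm
        constructor <;> linarith)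
  refine ⟨y, fun i => ?_⟩
  rw [hx i, sub_eq_add_neg (⟪u i, y⟫)]
  exact (hy i).symm

theorem sign_equivalent_iff_sameOpenFace {n m : ℕ} (hn : 1 ≤ n) (hm : 1 ≤ m)
    (u : Fin m → Euc n) (hu : ∀ i, u i ≠ 0) (a b : Fin m → ℝ) :
    signSet u a = signSet u b ↔ SameOpenFace u a b := by
  constructor
  · intro h
    exact forward_dir u a b h.le
  · intro h
    exact Set.Subset.antisymm (backward_dir u a b h)
      (backward_dir u b a fun c hc => (h c hc).symm)
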